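/- For real x > 0 and analytic f near [1,x] (or [x,1]), with g(t) = t·f(t), ∫₁^x f(t) dt = ∑_{n≥0} (-1)ⁿ g⁽ⁿ⁾(x) · (xⁿ/n!)·(log x - H_n) + ∑_{n≥0} (-1)ⁿ H_n g⁽ⁿ⁾(1)/n!, provided both series converge absolutely; in particular this holds for f(t) = e^t/t, g(t) = e^t. -/

import Mathlib

open MeasureTheory Set Filter Topology

/-- The power series with coefficients `a` centred at `y`, evaluated at `t`. -/
noncomputable def centeredSeries (a : ℕ → ℝ) (y t : ℝ) : ℝ := ∑' n, a n * (t - y) ^ n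

lemma continuousOn_centeredSeries {a : ℕ → ℝ} {y : ℝ}
    (h : Summable fun n => |a n| * y ^ n) :
    ContinuousOn (centeredSeries a y) (Icc 0 (2 * y)) := by
  refine continuousOn_tsum (fun n => by fun_prop) h fun n t ht => ?_
  rw [norm_mul, norm_pow, Real.norm_eq_abs, Real.norm_eq_abs]
  have : |t - y| ≤ y := abs_le.2 ⟨by linarith [ht.1], by linarith [ht.2]⟩
  gcongr

lemma summable_centeredSeries {a : ℕ → ℝ} {y t : ℝ}
    (h : Summable fun n => |a n| * y ^ n) (ht : t ∈ Icc 0 (2 * y)) :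
    Summable fun n => a n * (t - y) ^ n := by
  refine Summable.of_norm_bounded h fun n => ?_
  rw [norm_mul, norm_pow, Real.norm_eq_abs, Real.norm_eq_abs]
  have : |t - y| ≤ y := abs_le.2 ⟨by linarith [ht.1], by linarith [ht.2]⟩
  gcongr

lemma integral_geom_sum_one_sub_div {y : ℝ} (hy : 0 < y) (n : ℕ) :
    ∫ t in (0 : ℝ)..y, ∑ k ∈ Finset.range n, (1 - t / y) ^ k = y * (harmonic n : ℝ) := by
  rw [intervalIntegral.integral_finsetSum
    fun k _ => Continuous.intervalIntegrable (by fun_prop) _ _, harmonic, Rat.cast_sum,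
    Finset.mul_sum]
  refine Finset.sum_congr rfl fun k _ => ?_
  rw [intervalIntegral.integral_comp_sub_div (fun u => u ^ k) hy.ne' 1]
  simp [hy.ne']

lemma centeredSeries_sub_div {a : ℕ → ℝ} {y t : ℝ} (hy : 0 < y)
    (h : Summable fun n => |a n| * y ^ n) (ht : t ∈ Ioc 0 y) :
    HasSum (fun n => -(a n * (-y) ^ n / y) * ∑ k ∈ Finset.range n, (1 - t / y) ^ k)
      ((centeredSeries a y t - centeredSeries a y 0) / t) := by
  have e1 := (summable_centeredSeries h (t := t) ⟨ht.1.le, by linarith [ht.2]⟩).hasSum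
  have e2 := (summable_centeredSeries h (t := 0) ⟨le_rfl, by linarith⟩).hasSum
  convert! (e1.sub e2).div_const t using 2 with n
  have ht0 := ht.1.ne'
  have hg := geom_sum_mul (1 - t / y) n
  have hp : (t - y) ^ n = (-y) ^ n * (1 - t / y) ^ n := by
    rw [← mul_pow]; congr 1; field_simp; ring
  rw [zero_sub, hp, eq_div_iff ht0]
  have : (1 - t / y) ^ n = 1 + (∑ k ∈ Finset.range n, (1 - t / y) ^ k) * (-(t / y)) := by
    linear_combination -hg
  rw [this]
  field_simp
  ring

lemma integral_centeredSeries_sub_div {a : ℕ → ℝ} {y : ℝ} (hy : 0 < y)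
    (h : Summable fun n => |a n| * y ^ n)
    (hH : Summable fun n => |a n| * y ^ n * (harmonic n : ℝ)) :
    IntervalIntegrable (fun t => (centeredSeries a y t - centeredSeries a y 0) / t) volume 0 y ∧
      ∫ t in (0 : ℝ)..y, (centeredSeries a y t - centeredSeries a y 0) / t
        = -∑' n, a n * (-y) ^ n * (harmonic n : ℝ) := by
  set F : ℕ → ℝ → ℝ := fun n t => -(a n * (-y) ^ n / y) * ∑ k ∈ Finset.range n, (1 - t / y) ^ k
    with hF
  have hFc : ∀ n, Continuous (F n) := fun n => by fun_prop
  have hFi : ∀ n, Integrable (F n) (volume.restrict (Ioc 0 y)) := fun n =>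
    ((hFc n).intervalIntegrable 0 y).1
  have hint : ∀ n, ∫ t in Ioc 0 y, F n t = -(a n * (-y) ^ n * (harmonic n : ℝ)) := fun n => by
    rw [← intervalIntegral.integral_of_le hy.le, hF]
    simp only
    rw [intervalIntegral.integral_const_mul, integral_geom_sum_one_sub_div hy]
    field_simp
  have hnorm : ∀ n, ∫ t in Ioc 0 y, ‖F n t‖ = |a n| * y ^ n * (harmonic n : ℝ) := fun n => by
    have : ∀ t ∈ Ioc 0 y, ‖F n t‖ =
        (|a n| * y ^ n / y) * ∑ k ∈ Finset.range n, (1 - t / y) ^ k := fun t ht => by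
      have h1 : 0 ≤ 1 - t / y := by rw [sub_nonneg, div_le_one hy]; exact ht.2
      rw [hF]
      simp only [norm_mul, norm_neg, norm_div, norm_pow, Real.norm_eq_abs, abs_of_pos hy]
      rw [abs_of_nonneg (Finset.sum_nonneg fun k _ => pow_nonneg h1 k)]
    rw [setIntegral_congr_fun measurableSet_Ioc this, ← intervalIntegral.integral_of_le hy.le,
      intervalIntegral.integral_const_mul, integral_geom_sum_one_sub_div hy]
    field_simp
  have hsum : Summable fun n => ∫ t in Ioc 0 y, ‖F n t‖ := by simpa only [hnorm] using hH
  have hae : ∀ t ∈ Ioc 0 y, ∑' n, F n t =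
      (centeredSeries a y t - centeredSeries a y 0) / t := fun t ht =>
    (centeredSeries_sub_div hy h ht).tsum_eq
  constructor
  · rw [intervalIntegrable_iff_integrableOn_Ioc_of_le hy.le]
    have hcont : ContinuousOn (fun t => (centeredSeries a y t - centeredSeries a y 0) / t)
        (Ioc 0 y) :=
      (((continuousOn_centeredSeries h).mono fun t ht =>
        ⟨ht.1.le, by linarith [ht.2]⟩).sub continuousOn_const).div continuousOn_id
          fun t ht => ht.1.ne'
    refine ⟨hcont.aestronglyMeasurable measurableSet_Ioc, ?_⟩
    have hlt : ∑' n, ∫⁻ t in Ioc 0 y, ‖F n t‖ₑ ≠ ⊤ := by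
      have : ∀ n, ∫⁻ t in Ioc 0 y, ‖F n t‖ₑ = ENNReal.ofReal (∫ t in Ioc 0 y, ‖F n t‖) :=
        fun n => (ofReal_integral_norm_eq_lintegral_enorm (hFi n)).symm
      simp_rw [this]
      exact hsum.tsum_ofReal_ne_top
    rw [hasFiniteIntegral_iff_enorm]
    refine lt_of_le_of_lt ?_ (lt_top_iff_ne_top.2 hlt)
    rw [← lintegral_tsum fun n => (hFc n).enorm.aemeasurable]
    refine setLIntegral_mono' measurableSet_Ioc fun t ht => ?_
    rw [← hae t ht]
    exact enorm_tsum_le_tsum_enorm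
  · rw [intervalIntegral.integral_of_le hy.le, ← setIntegral_congr_fun measurableSet_Ioc hae,
      ← (hasSum_integral_of_summable_integral_norm hFi hsum).tsum_eq]
    simp_rw [hint]
    exact tsum_neg

lemma analyticOnNhd_centeredSeries {a : ℕ → ℝ} {y : ℝ} (hy : 0 < y)
    (h : Summable fun n => |a n| * y ^ n) :
    AnalyticOnNhd ℝ (centeredSeries a y) (Ioo 0 (2 * y)) := by
  set p := FormalMultilinearSeries.ofScalars ℝ a
  have hr : ENNReal.ofReal y ≤ p.radius := by
    refine p.le_radius_of_summable_norm (r := y.toNNReal) ?_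
    simpa [p, FormalMultilinearSeries.ofScalars_norm, Real.coe_toNNReal _ hy.le] using h
  have hpos : 0 < p.radius := (ENNReal.ofReal_pos.2 hy).trans_le hr
  have hp : HasFPowerSeriesOnBall (fun t => p.sum (t - y)) p y p.radius := by
    simpa using (p.hasFPowerSeriesOnBall hpos).comp_sub y
  have hG : centeredSeries a y = fun t => p.sum (t - y) := by
    ext t
    simp [centeredSeries, FormalMultilinearSeries.sum, p, mul_comm]
  rw [hG]
  refine hp.analyticOnNhd.mono fun t ht => ?_
  refine Metric.eball_subset_eball hr ?_
  rw [Metric.eball_ofReal, Metric.mem_ball, Real.dist_eq, abs_lt]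
  exact ⟨by linarith [ht.1], by linarith [ht.2]⟩

/-- The coefficients of the Taylor series of `g` at `y`. -/
noncomputable def taylorSeriesCoeff (g : ℝ → ℝ) (y : ℝ) (n : ℕ) : ℝ :=
  iteratedDeriv n g y / n.factorial

lemma AnalyticAt.eventuallyEq_centeredSeries {g : ℝ → ℝ} {y : ℝ} (hg : AnalyticAt ℝ g y) :
    g =ᶠ[𝓝 y] centeredSeries (taylorSeriesCoeff g y) y := by
  filter_upwards [hg.hasFPowerSeriesAt.eventually_hasSum_sub] with t ht
  simpa [centeredSeries, taylorSeriesCoeff, mul_comm] using ht.tsum_eq.symm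

lemma exists_convex_isOpen_analyticOnNhd {g : ℝ → ℝ} {p q : ℝ}
    (hg : ∀ t ∈ Icc p q, AnalyticAt ℝ g t) :
    ∃ U, Icc p q ⊆ U ∧ IsOpen U ∧ Convex ℝ U ∧ AnalyticOnNhd ℝ g U := by
  obtain ⟨δ, hδ, hsub⟩ := (isCompact_Icc (a := p) (b := q)).exists_thickening_subset_open
    (isOpen_analyticAt ℝ g) hg
  exact ⟨_, Metric.self_subset_thickening hδ _, Metric.isOpen_thickening,
    (convex_Icc p q).thickening δ, fun t ht => hsub ht⟩

/-- The Taylor series of `g` at `y` converges absolutely at distance `y` from its centre, and so does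
the series with its terms weighted by harmonic numbers. -/
def HarmonicSummable (g : ℝ → ℝ) (y : ℝ) : Prop :=
  (Summable fun n => |taylorSeriesCoeff g y n| * y ^ n) ∧
    Summable fun n => |taylorSeriesCoeff g y n| * y ^ n * (harmonic n : ℝ)

lemma integral_div_eq_sub {g : ℝ → ℝ} {p q : ℝ} (hp : 0 < p) (hpq : p ≤ q)
    (hg : ∀ t ∈ Icc p q, AnalyticAt ℝ g t)
    (hsp : HarmonicSummable g p) (hsq : HarmonicSummable g q) :
    ∫ t in p..q, g t / t =
      (Real.log q * ∑' n, taylorSeriesCoeff g q n * (-q) ^ n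
          - ∑' n, taylorSeriesCoeff g q n * (-q) ^ n * (harmonic n : ℝ))
        - (Real.log p * ∑' n, taylorSeriesCoeff g p n * (-p) ^ n
          - ∑' n, taylorSeriesCoeff g p n * (-p) ^ n * (harmonic n : ℝ)) := by
  have hq : 0 < q := hp.trans_le hpq
  set P := centeredSeries (taylorSeriesCoeff g p) p with hP
  set Q := centeredSeries (taylorSeriesCoeff g q) q with hQ
  have hPa : AnalyticOnNhd ℝ P (Ioo 0 (2 * p)) := analyticOnNhd_centeredSeries hp hsp.1
  have hQa : AnalyticOnNhd ℝ Q (Ioo 0 (2 * q)) := analyticOnNhd_centeredSeries hq hsq.1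
  obtain ⟨U, hIU, hUo, hUc, hgU⟩ := exists_convex_isOpen_analyticOnNhd hg
  have hpU : p ∈ U ∩ Ioo 0 (2 * q) := ⟨hIU (left_mem_Icc.2 hpq), hp, by linarith⟩
  have hgQ : EqOn g Q (U ∩ Ioo 0 (2 * q)) :=
    (hgU.mono inter_subset_left).eqOn_of_preconnected_of_eventuallyEq
      (hQa.mono inter_subset_right) (hUc.inter (convex_Ioo _ _)).isPreconnected
      ⟨hIU (right_mem_Icc.2 hpq), hq, by linarith⟩
      (hg q (right_mem_Icc.2 hpq)).eventuallyEq_centeredSeries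
  have hPQ : EqOn P Q (Ioo 0 (2 * p)) :=
    hPa.eqOn_of_preconnected_of_eventuallyEq
      (hQa.mono (Ioo_subset_Ioo_right (by linarith))) isPreconnected_Ioo
      (z₀ := p) ⟨hp, by linarith⟩
      ((hg p (left_mem_Icc.2 hpq)).eventuallyEq_centeredSeries.symm.trans
        (hgQ.eventuallyEq_of_mem ((hUo.inter isOpen_Ioo).mem_nhds hpU)))
  have hPQ0 : P 0 = Q 0 := by
    have hPc : ContinuousOn P (Icc 0 (2 * p)) := continuousOn_centeredSeries hsp.1
    have hQc : ContinuousOn Q (Icc 0 (2 * p)) :=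
      (continuousOn_centeredSeries hsq.1).mono (Icc_subset_Icc_right (by linarith))
    refine hPQ.of_subset_closure hPc hQc Ioo_subset_Icc_self ?_ ⟨le_rfl, by linarith⟩
    rw [closure_Ioo (by linarith)]
  obtain ⟨hPi, hPs⟩ := integral_centeredSeries_sub_div hp hsp.1 hsp.2
  obtain ⟨hQi, hQs⟩ := integral_centeredSeries_sub_div hq hsq.1 hsq.2
  rw [← hP] at hPi hPs
  rw [← hQ] at hQi hQs
  have hQi1 : IntervalIntegrable (fun t => (Q t - Q 0) / t) volume 0 p :=
    hQi.mono_set (by rw [uIcc_of_le hp.le, uIcc_of_le hq.le]; exact Icc_subset_Icc_right hpq)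
  have hQi2 : IntervalIntegrable (fun t => (Q t - Q 0) / t) volume p q :=
    hQi.mono_set (by rw [uIcc_of_le hpq, uIcc_of_le hq.le]; exact Icc_subset_Icc_left hp.le)
  have hsplit := intervalIntegral.integral_add_adjacent_intervals hQi1 hQi2
  have hleft : ∫ t in (0 : ℝ)..p, (Q t - Q 0) / t = ∫ t in (0 : ℝ)..p, (P t - P 0) / t := by
    refine intervalIntegral.integral_congr_Ioo_of_le hp.le fun t ht => ?_
    rw [hPQ0, hPQ ⟨ht.1, by linarith [ht.2]⟩]
  have hinv : IntervalIntegrable (fun t : ℝ => Q 0 * t⁻¹) volume p q :=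
    (ContinuousOn.intervalIntegrable <| continuousOn_id.inv₀ fun t ht =>
      ((lt_min hp hq).trans_le ht.1).ne').const_mul _
  have hmid : ∫ t in p..q, g t / t =
      (∫ t in p..q, (Q t - Q 0) / t) + Q 0 * (Real.log q - Real.log p) := by
    rw [← Real.log_div hq.ne' hp.ne', ← integral_inv_of_pos hp hq,
      ← intervalIntegral.integral_const_mul, ← intervalIntegral.integral_add hQi2 hinv]
    refine intervalIntegral.integral_congr fun t ht => ?_
    rw [uIcc_of_le hpq] at ht
    rw [hgQ ⟨hIU ht, hp.trans_le ht.1, by linarith [ht.2]⟩]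
    ring
  have hP0 : P 0 = ∑' n, taylorSeriesCoeff g p n * (-p) ^ n := by simp [hP, centeredSeries]
  have hQ0 : Q 0 = ∑' n, taylorSeriesCoeff g q n * (-q) ^ n := by simp [hQ, centeredSeries]
  rw [hmid, ← hP0, ← hQ0, hPQ0]
  linear_combination hsplit - hleft - hPs + hQs

lemma one_le_harmonic {n : ℕ} (hn : n ≠ 0) : (1 : ℝ) ≤ harmonic n := by
  have : (1 : ℚ) ≤ harmonic n := by
    rw [harmonic]
    refine le_trans (by simp) (Finset.single_le_sum (f := fun i : ℕ => ((i + 1 : ℕ) : ℚ)⁻¹)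
      (fun i _ => by positivity) (Finset.mem_range.2 (Nat.pos_of_ne_zero hn)))
  exact_mod_cast this

lemma tendsto_harmonic_atTop : Tendsto (fun n : ℕ => (harmonic n : ℝ)) atTop atTop :=
  tendsto_atTop_mono log_add_one_le_harmonic
    (Real.tendsto_log_atTop.comp
      (tendsto_natCast_atTop_atTop.comp (tendsto_add_atTop_nat 1)))

lemma harmonicSummable_of_summable {g : ℝ → ℝ} {y : ℝ} (hy : 0 < y)
    (h : Summable fun n => |taylorSeriesCoeff g y n| * y ^ n * |Real.log y - (harmonic n : ℝ)|) :
    HarmonicSummable g y := by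
  have hH : Summable fun n => |taylorSeriesCoeff g y n| * y ^ n * (harmonic n : ℝ) := by
    refine (h.mul_left 2).of_norm_bounded_eventually_nat ?_
    filter_upwards [tendsto_harmonic_atTop.eventually_ge_atTop (2 * Real.log y),
      tendsto_harmonic_atTop.eventually_ge_atTop 0] with n hn h0
    rw [Real.norm_of_nonneg (by positivity), mul_left_comm]
    gcongr
    linarith [neg_le_abs (Real.log y - (harmonic n : ℝ))]
  refine ⟨hH.of_norm_bounded_eventually_nat ?_, hH⟩
  filter_upwards [eventually_ne_atTop 0] with n hn
  rw [Real.norm_of_nonneg (by positivity)]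
  exact le_mul_of_one_le_right (by positivity) (one_le_harmonic hn)

lemma tsum_mul_log_sub_harmonic {g : ℝ → ℝ} {y : ℝ} (hy : 0 < y) (h : HarmonicSummable g y) :
    ∑' n : ℕ, (-1) ^ n * iteratedDeriv n g y *
        (y ^ n / Nat.factorial n * (Real.log y - (harmonic n : ℝ))) =
      Real.log y * ∑' n, taylorSeriesCoeff g y n * (-y) ^ n
        - ∑' n, taylorSeriesCoeff g y n * (-y) ^ n * (harmonic n : ℝ) := by
  have h1 : Summable fun n => taylorSeriesCoeff g y n * (-y) ^ n :=
    h.1.of_norm_bounded fun n => by simp [abs_of_pos hy]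
  have h2 : Summable fun n => taylorSeriesCoeff g y n * (-y) ^ n * (harmonic n : ℝ) :=
    h.2.of_norm_bounded_eventually_nat <| by
      filter_upwards [eventually_ne_atTop 0] with n hn
      rw [norm_mul, Real.norm_of_nonneg (zero_le_one.trans (one_le_harmonic hn))]
      simp [abs_of_pos hy]
  rw [← tsum_mul_left, ← (h1.mul_left _).tsum_sub h2]
  refine tsum_congr fun n => ?_
  rw [taylorSeriesCoeff, neg_pow y]
  ring

theorem stmt_17 (x : ℝ) (hx : 0 < x) (f g : ℝ → ℝ)
    (hg : g = fun t => t * f t)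
    (hf : ∀ t ∈ Set.uIcc 1 x, AnalyticAt ℝ f t)
    (h1 : Summable fun n : ℕ =>
      |(-1) ^ n * iteratedDeriv n g x * (x ^ n / Nat.factorial n * (Real.log x - (harmonic n : ℝ)))|)
    (h2 : Summable fun n : ℕ =>
      |(-1) ^ n * (harmonic n : ℝ) * iteratedDeriv n g 1 / Nat.factorial n|) :
    ∫ t in (1:ℝ)..x, f t
      = (∑' n : ℕ, (-1) ^ n * iteratedDeriv n g x *
          (x ^ n / Nat.factorial n * (Real.log x - (harmonic n : ℝ))))
        + ∑' n : ℕ, (-1) ^ n * (harmonic n : ℝ) * iteratedDeriv n g 1 / Nat.factorial n := by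
  have hga : ∀ t ∈ uIcc 1 x, AnalyticAt ℝ g t := fun t ht => by
    rw [hg]; exact analyticAt_id.mul (hf t ht)
  have hsx : HarmonicSummable g x := harmonicSummable_of_summable hx <| h1.congr fun n => by
    simp only [taylorSeriesCoeff, abs_mul, abs_div, abs_pow, abs_neg, abs_one, one_pow,
      abs_of_pos hx, Nat.abs_cast]
    ring
  have hs1 : HarmonicSummable g 1 := harmonicSummable_of_summable one_pos <| h2.congr fun n => by
    simp only [taylorSeriesCoeff, abs_mul, abs_div, abs_pow, abs_neg, abs_one, one_pow,
      Nat.abs_cast, Real.log_one, zero_sub]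
    ring
  have hfg : ∫ t in (1 : ℝ)..x, f t = ∫ t in (1 : ℝ)..x, g t / t := by
    refine intervalIntegral.integral_congr fun t ht => ?_
    have ht0 : t ≠ 0 := ((lt_min one_pos hx).trans_le ht.1).ne'
    simp only [hg]
    field_simp
  have hS1 : ∑' n : ℕ, (-1) ^ n * (harmonic n : ℝ) * iteratedDeriv n g 1 / Nat.factorial n =
      ∑' n, taylorSeriesCoeff g 1 n * (-1) ^ n * (harmonic n : ℝ) :=
    tsum_congr fun n => by rw [taylorSeriesCoeff]; ring
  rw [hfg, tsum_mul_log_sub_harmonic hx hsx, hS1]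
  rcases le_total 1 x with h | h
  · rw [uIcc_of_le h] at hga
    rw [integral_div_eq_sub one_pos h hga hs1 hsx, Real.log_one]
    ring
  · rw [uIcc_of_ge h] at hga
    rw [intervalIntegral.integral_symm, integral_div_eq_sub hx h hga hsx hs1, Real.log_one]
    ring
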